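/- Let N ≥ 1 and let Ω be the standard symplectic form on ℝ^{2N}. Let V_σ be a real symmetric 2N×2N matrix such that V_σ is positive definite and the complex matrix V_σ + iΩ is positive definite, and let V_ζ be a real symmetric 2N×2N matrix such that V_ζ + iΩ is positive semidefinite (as a complex matrix) and V_σ − V_ζ is positive definite. Then there exists a real symmetric 2N×2N matrix W with W + iΩ positive semidefinite such that f_σ(W) = V_ζ; explicitly, W = −V_σ − X_{V_σ} (V_ζ − V_σ)⁻¹ X_{V_σ} works. -/

import Mathlib

open Matrix
open scoped ComplexOrder

noncomputable section

/-- The standard symplectic form on `ℝ^(2N)`: block diagonal with `N` blocks `[[0,1],[-1,0]]`. -/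
def symp (N : ℕ) : Matrix (Fin (2*N)) (Fin (2*N)) ℝ :=
  Matrix.of fun i j =>
    if i.val % 2 = 0 ∧ j.val = i.val + 1 then 1
    else if j.val % 2 = 0 ∧ i.val = j.val + 1 then -1
    else 0

/-- View a real matrix as a complex matrix. -/
def cplx {n : Type*} (M : Matrix n n ℝ) : Matrix n n ℂ :=
  M.map (fun x => (x : ℂ))

/-- `V` is a bona fide quantum covariance matrix w.r.t. the symplectic form `Om`:
the complex matrix `V + i·Om` is positive semidefinite. -/
def BonaFide {n : Type*} [Fintype n] (V Om : Matrix n n ℝ) : Prop :=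
  (cplx V + Complex.I • cplx Om).PosSemidef

/-- The (positive semidefinite) square root of a positive semidefinite real matrix,
via the continuous functional calculus. -/
def msqrt {n : Type*} [Fintype n] [DecidableEq n] (M : Matrix n n ℝ) : Matrix n n ℝ :=
  cfc Real.sqrt M

/-- `X_V = V^{1/2} (I + A⁻²)^{1/2} V^{1/2}` where `A = V^{1/2} Ω V^{1/2}`. -/
def Xmat {n : Type*} [Fintype n] [DecidableEq n] (V Om : Matrix n n ℝ) : Matrix n n ℝ :=
  msqrt V * msqrt (1 + (msqrt V * Om * msqrt V)⁻¹ * (msqrt V * Om * msqrt V)⁻¹) * msqrt V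

lemma symp_transpose (N : ℕ) : (symp N)ᵀ = -symp N := by
  ext i j
  simp only [symp, transpose_apply, of_apply, Matrix.neg_apply]
  split_ifs <;> first | omega | norm_num

lemma symp_mul_symp (N : ℕ) : symp N * symp N = -1 := by
  ext i k
  rw [mul_apply]
  have key : ∀ p : Fin (2*N), (∀ j, j ≠ p → symp N i j = 0) →
      symp N i p * symp N p k = (-1 : Matrix (Fin (2*N)) (Fin (2*N)) ℝ) i k →
      ∑ j, symp N i j * symp N j k = (-1 : Matrix (Fin (2*N)) (Fin (2*N)) ℝ) i k := by
    intro p hp h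
    rw [Finset.sum_eq_single p, h]
    · intro j _ hj
      rw [hp j hj, zero_mul]
    · simp
  by_cases hi : i.val % 2 = 0
  · have hlt : i.val + 1 < 2 * N := by omega
    refine key ⟨i.val + 1, hlt⟩ ?_ ?_
    · intro j hj
      have : j.val ≠ i.val + 1 := fun h => hj (Fin.ext h)
      simp only [symp, of_apply]
      split_ifs <;> first | omega | rfl
    · simp only [symp, of_apply, Matrix.neg_apply, one_apply, Fin.ext_iff]
      split_ifs <;> first | omega | (norm_num; done) | simp_all
  · have hlt : i.val - 1 < 2 * N := by omega
    refine key ⟨i.val - 1, hlt⟩ ?_ ?_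
    · intro j hj
      have : j.val ≠ i.val - 1 := fun h => hj (Fin.ext h)
      simp only [symp, of_apply]
      split_ifs <;> first | omega | rfl
    · simp only [symp, of_apply, Matrix.neg_apply, one_apply, Fin.ext_iff]
      split_ifs <;> first | omega | (norm_num; done) | simp_all

section aux
variable {n : Type*} [Fintype n] [DecidableEq n]

lemma msqrt_isHermitian (M : Matrix n n ℝ) : (msqrt M).IsHermitian :=
  cfc_predicate (p := IsSelfAdjoint) Real.sqrt M

lemma msqrt_mul_self {M : Matrix n n ℝ} (hM : M.PosSemidef) : msqrt M * msqrt M = M := by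
  have h := posSemidef_iff_isHermitian_and_spectrum_nonneg.1 hM
  have hsa : IsSelfAdjoint M := h.1
  unfold msqrt
  rw [← cfc_mul Real.sqrt Real.sqrt M]
  conv_rhs => rw [← cfc_id ℝ M]
  refine cfc_congr ?_
  intro x hx
  exact Real.mul_self_sqrt (h.2 hx)

lemma cplx_mul (A B : Matrix n n ℝ) : cplx (A * B) = cplx A * cplx B :=
  map_mul (Complex.ofRealHom.mapMatrix (m := n)) A B

lemma cplx_add (A B : Matrix n n ℝ) : cplx (A + B) = cplx A + cplx B :=
  map_add (Complex.ofRealHom.mapMatrix (m := n)) A B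

lemma cplx_sub (A B : Matrix n n ℝ) : cplx (A - B) = cplx A - cplx B :=
  map_sub (Complex.ofRealHom.mapMatrix (m := n)) A B

lemma cplx_neg (A : Matrix n n ℝ) : cplx (-A) = -cplx A :=
  map_neg (Complex.ofRealHom.mapMatrix (m := n)) A

lemma cplx_one : cplx (1 : Matrix n n ℝ) = 1 :=
  map_one (Complex.ofRealHom.mapMatrix (m := n))

lemma cplx_conjTranspose (A : Matrix n n ℝ) : (cplx A)ᴴ = cplx Aᵀ := by
  ext i j; simp [cplx]

lemma cplx_transpose (A : Matrix n n ℝ) : (cplx A)ᵀ = cplx Aᵀ := by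
  ext i j; simp [cplx]

lemma cplx_det (A : Matrix n n ℝ) : (cplx A).det = (A.det : ℂ) :=
  (RingHom.map_det Complex.ofRealHom A).symm

lemma cplx_posSemidef {M : Matrix n n ℝ} (hM : M.PosSemidef) : (cplx M).PosSemidef := by
  have h1 := msqrt_isHermitian M
  have h2 : (cplx (msqrt M))ᴴ * cplx (msqrt M) = cplx M := by
    rw [cplx_conjTranspose, ← conjTranspose_eq_transpose_of_trivial, h1.eq, ← cplx_mul,
      msqrt_mul_self hM]
  rw [← h2]
  exact posSemidef_conjTranspose_mul_self _

lemma posSemidef_of_cplx {M : Matrix n n ℝ} (hM : (cplx M).PosSemidef) : M.PosSemidef := by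
  have hh : M.IsHermitian := by
    have := hM.isHermitian.eq
    ext i j
    have h := congrFun (congrFun this i) j
    simpa [cplx] using h
  refine PosSemidef.of_dotProduct_mulVec_nonneg hh fun x => ?_
  have h := hM.dotProduct_mulVec_nonneg (fun i => (x i : ℂ))
  have e : star (fun i => (x i : ℂ)) ⬝ᵥ (cplx M *ᵥ fun i => (x i : ℂ))
      = ((star x ⬝ᵥ (M *ᵥ x) : ℝ) : ℂ) := by
    simp [dotProduct, mulVec, cplx]
  rw [e] at h
  exact_mod_cast h

/-- Antitonicity of the inverse. -/
lemma inv_sub_inv_psd {D Q : Matrix n n ℂ} (hD : D.PosSemidef) (hDu : IsUnit D.det)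
    (hQ : Q.PosSemidef) (hQu : IsUnit Q.det) (h : (Q - D).PosSemidef) :
    (D⁻¹ - Q⁻¹).PosSemidef := by
  have e : D⁻¹ - Q⁻¹ = Q⁻¹ * (Q - D) * Q⁻¹ + (Q⁻¹ * (Q - D)) * D⁻¹ * ((Q - D) * Q⁻¹) := by
    have a1 : Q⁻¹ * (Q - D) = 1 - Q⁻¹ * D := by rw [mul_sub, nonsing_inv_mul _ hQu]
    have a2 : (Q - D) * Q⁻¹ = 1 - D * Q⁻¹ := by rw [sub_mul, mul_nonsing_inv _ hQu]
    have a3 : D⁻¹ * (1 - D * Q⁻¹) = D⁻¹ - Q⁻¹ := by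
      rw [mul_sub, ← mul_assoc, nonsing_inv_mul _ hDu, one_mul, mul_one]
    rw [a1, a2, mul_assoc _ D⁻¹, a3, sub_mul, sub_mul, one_mul, one_mul, mul_sub,
      mul_assoc, mul_assoc, mul_nonsing_inv _ hDu]
    noncomm_ring
  rw [e]
  have hQi : (Q⁻¹)ᴴ = Q⁻¹ := hQ.inv.isHermitian.eq
  refine PosSemidef.add ?_ ?_
  · have := h.mul_mul_conjTranspose_same Q⁻¹
    rwa [hQi] at this
  · have := hD.inv.mul_mul_conjTranspose_same (Q⁻¹ * (Q - D))
    rwa [conjTranspose_mul, hQi, h.isHermitian.eq] at this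

lemma Xmat_facts {V Om : Matrix n n ℝ} (hV : V.PosDef) (hOm : Om * Om = -1) (hOmT : Omᵀ = -Om)
    (hQ : (cplx V + Complex.I • cplx Om).PosDef) :
    (Xmat V Om)ᵀ = Xmat V Om ∧ IsUnit (Xmat V Om).det ∧
    cplx (Xmat V Om) * (cplx V + Complex.I • cplx Om)⁻¹ * cplx (Xmat V Om)
      = cplx V - Complex.I • cplx Om := by
  have hSS := msqrt_mul_self hV.posSemidef
  have hST : (msqrt V)ᵀ = msqrt V := by
    rw [← conjTranspose_eq_transpose_of_trivial]; exact msqrt_isHermitian V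
  unfold Xmat
  generalize msqrt V = S at *
  have hVu : IsUnit V.det := (isUnit_iff_isUnit_det _).1 hV.isUnit
  have hSu : IsUnit S.det := by
    rw [← hSS, det_mul] at hVu
    exact isUnit_of_mul_isUnit_left hVu
  obtain ⟨B, hB⟩ : ∃ B, B = S⁻¹ * Om * S⁻¹ := ⟨_, rfl⟩
  have hS1 : S * S⁻¹ = 1 := mul_nonsing_inv _ hSu
  have hS2 : S⁻¹ * S = 1 := nonsing_inv_mul _ hSu
  have hSiT : (S⁻¹)ᵀ = S⁻¹ := by rw [transpose_nonsing_inv, hST]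
  have hBT : Bᵀ = -B := by
    rw [hB, transpose_mul, transpose_mul, hSiT, hOmT]; noncomm_ring
  have hSBS : S * B * S = Om := by
    calc S * B * S = (S * S⁻¹) * Om * (S⁻¹ * S) := by rw [hB]; noncomm_ring
      _ = Om := by rw [hS1, hS2, one_mul, mul_one]
  have hAi : (S * Om * S)⁻¹ = -B := by
    apply inv_eq_right_inv
    calc S * Om * S * -B = -(S * Om * (S * S⁻¹) * Om * S⁻¹) := by rw [hB]; noncomm_ring
      _ = -(S * (Om * Om) * S⁻¹) := by rw [hS1]; noncomm_ring
      _ = S * S⁻¹ := by rw [hOm]; noncomm_ring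
      _ = 1 := hS1
  have hAA : 1 + (S * Om * S)⁻¹ * (S * Om * S)⁻¹ = 1 + B * B := by rw [hAi]; noncomm_ring
  rw [hAA]
  obtain ⟨T, hT⟩ : ∃ T, T = 1 + Complex.I • cplx B := ⟨_, rfl⟩
  obtain ⟨T', hT'⟩ : ∃ T', T' = 1 - Complex.I • cplx B := ⟨_, rfl⟩
  have hcS1 : cplx S * cplx S⁻¹ = 1 := by rw [← cplx_mul, hS1, cplx_one]
  have hcS2 : cplx S⁻¹ * cplx S = 1 := by rw [← cplx_mul, hS2, cplx_one]
  have hQT : cplx S * T * cplx S = cplx V + Complex.I • cplx Om := by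
    rw [hT, ← hSS, ← hSBS]
    simp only [cplx_mul, mul_add, add_mul, mul_one, mul_smul_comm, smul_mul_assoc]
  have hPT : cplx S * T' * cplx S = cplx V - Complex.I • cplx Om := by
    rw [hT', ← hSS, ← hSBS]
    simp only [cplx_mul, mul_sub, sub_mul, mul_one, mul_smul_comm, smul_mul_assoc]
  have hTQ : T = cplx S⁻¹ * (cplx V + Complex.I • cplx Om) * cplx S⁻¹ := by
    rw [← hQT]
    calc T = (cplx S⁻¹ * cplx S) * T * (cplx S * cplx S⁻¹) := by rw [hcS1, hcS2]; simp
      _ = _ := by noncomm_ring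
  have hTp : T.PosSemidef := by
    have := hQ.posSemidef.mul_mul_conjTranspose_same (cplx S⁻¹)
    rwa [cplx_conjTranspose, hSiT, ← hTQ] at this
  have hTT : Tᵀ = T' := by
    rw [hT, hT', transpose_add, transpose_smul, cplx_transpose, hBT, cplx_neg, transpose_one,
      smul_neg, sub_eq_add_neg]
  have hTp' : T'.PosSemidef := hTT ▸ hTp.transpose
  have hQu : IsUnit (cplx V + Complex.I • cplx Om).det := (isUnit_iff_isUnit_det _).1 hQ.isUnit
  have hTu : IsUnit T.det := by
    rw [← hQT, det_mul, det_mul] at hQu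
    exact isUnit_of_mul_isUnit_right (isUnit_of_mul_isUnit_left hQu)
  have hTu' : IsUnit T'.det := by rw [← hTT, det_transpose]; exact hTu
  have hII : (Complex.I • cplx B) * (Complex.I • cplx B) = -(cplx B * cplx B) := by
    rw [smul_mul_smul_comm, Complex.I_mul_I, neg_one_smul]
  have hprod : T * T' = cplx (1 + B * B) := by
    rw [cplx_add, cplx_mul, cplx_one, hT, hT']
    calc _ = 1 - (Complex.I • cplx B) * (Complex.I • cplx B) := by
            generalize Complex.I • cplx B = Y; noncomm_ring
      _ = _ := by rw [hII, sub_neg_eq_add]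
  have hprod' : T' * T = cplx (1 + B * B) := by
    rw [cplx_add, cplx_mul, cplx_one, hT, hT']
    calc _ = 1 - (Complex.I • cplx B) * (Complex.I • cplx B) := by
            generalize Complex.I • cplx B = Y; noncomm_ring
      _ = _ := by rw [hII, sub_neg_eq_add]
  have hpsdC : (cplx (1 + B * B)).PosSemidef := by
    have h1 : (T * T' * T + T' * T * T').PosSemidef := by
      refine PosSemidef.add ?_ ?_
      · have := hTp'.mul_mul_conjTranspose_same T
        rwa [hTp.isHermitian.eq] at this
      · have := hTp.mul_mul_conjTranspose_same T'
        rwa [hTp'.isHermitian.eq] at this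
    have hsum : T + T' = (2 : ℂ) • 1 := by
      rw [hT, hT', two_smul]; abel
    have h2 : T * T' * T + T' * T * T' = (2 : ℂ) • cplx (1 + B * B) := by
      rw [hprod', hprod, ← mul_add, hsum, mul_smul_comm, mul_one]
    have h3 := h1.smul (show (0 : ℂ) ≤ 2⁻¹ by positivity)
    rwa [h2, smul_smul, inv_mul_cancel₀ two_ne_zero, one_smul] at h3
  have hpsd := posSemidef_of_cplx hpsdC
  have hRR := msqrt_mul_self hpsd
  have hRT : (msqrt (1 + B * B))ᵀ = msqrt (1 + B * B) := by
    rw [← conjTranspose_eq_transpose_of_trivial]; exact msqrt_isHermitian _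
  have hRB : Commute (msqrt (1 + B * B)) B := by
    unfold msqrt
    apply Commute.cfc_real
    exact (Commute.one_left B).add_left ((Commute.refl B).mul_left (Commute.refl B))
  generalize msqrt (1 + B * B) = R at *
  have hRT2 : cplx R * T = T * cplx R := by
    rw [hT, mul_add, add_mul, mul_smul_comm, smul_mul_assoc, ← cplx_mul, ← cplx_mul, hRB.eq,
      mul_one, one_mul]
  have hRu : IsUnit R.det := by
    have h1 : IsUnit (cplx (R * R)).det := by
      rw [hRR, ← hprod, det_mul]; exact hTu.mul hTu'
    rw [cplx_det, det_mul] at h1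
    rw [isUnit_iff_ne_zero] at h1 ⊢
    rintro h0
    simp [h0] at h1
  refine ⟨?_, ?_, ?_⟩
  · rw [transpose_mul, transpose_mul, hST, hRT, mul_assoc]
  · rw [det_mul, det_mul]; exact (hSu.mul hRu).mul hSu
  · have hT1 : T * T⁻¹ = 1 := mul_nonsing_inv _ hTu
    have hT2 : T⁻¹ * T = 1 := nonsing_inv_mul _ hTu
    have hQi : (cplx V + Complex.I • cplx Om)⁻¹ = cplx S⁻¹ * T⁻¹ * cplx S⁻¹ := by
      rw [← hQT]
      apply inv_eq_right_inv
      calc _ = cplx S * T * (cplx S * cplx S⁻¹) * T⁻¹ * cplx S⁻¹ := by noncomm_ring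
        _ = cplx S * (T * T⁻¹) * cplx S⁻¹ := by rw [hcS1]; noncomm_ring
        _ = 1 := by rw [hT1, mul_one, hcS1]
    have hRTi : T⁻¹ * cplx R = cplx R * T⁻¹ := by
      calc T⁻¹ * cplx R = T⁻¹ * (cplx R * T) * T⁻¹ := by
            rw [mul_assoc, mul_assoc, hT1, mul_one]
        _ = (T⁻¹ * T) * cplx R * T⁻¹ := by rw [hRT2]; noncomm_ring
        _ = _ := by rw [hT2, one_mul]
    rw [hQi, ← hPT]
    simp only [cplx_mul]
    calc _ = cplx S * cplx R * (cplx S * cplx S⁻¹) * T⁻¹ * (cplx S⁻¹ * cplx S) * cplx R * cplx S := by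
            noncomm_ring
      _ = cplx S * cplx R * (T⁻¹ * cplx R) * cplx S := by rw [hcS1, hcS2]; noncomm_ring
      _ = cplx S * ((cplx R * cplx R) * T⁻¹) * cplx S := by rw [hRTi]; noncomm_ring
      _ = cplx S * (T' * (T * T⁻¹)) * cplx S := by
            rw [← cplx_mul, hRR, ← hprod', mul_assoc T']
      _ = _ := by rw [hT1, mul_one]

end aux

/-- if `V_ζ` is bona fide and `V_σ − V_ζ` is positive definite, then `V_ζ` is in
the image of `f_σ`: the bona fide matrix `W = −V_σ − X_{V_σ}(V_ζ−V_σ)⁻¹X_{V_σ}` satisfies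
`f_σ(W) = V_ζ`. -/
theorem exists_seed_of_posDef (N : ℕ) (hN : 1 ≤ N)
    (Vσ Vζ : Matrix (Fin (2*N)) (Fin (2*N)) ℝ)
    (hVσsymm : Vσ.IsSymm) (hVσpd : Vσ.PosDef)
    (hVσpdC : (cplx Vσ + Complex.I • cplx (symp N)).PosDef)
    (hVζsymm : Vζ.IsSymm)
    (hVζbf : BonaFide Vζ (symp N))
    (hdiff : (Vσ - Vζ).PosDef) :
    ∃ W : Matrix (Fin (2*N)) (Fin (2*N)) ℝ, W.IsSymm ∧ BonaFide W (symp N) ∧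
      Vσ - Xmat Vσ (symp N) * (Vσ + W)⁻¹ * Xmat Vσ (symp N) = Vζ ∧
      W = -Vσ - Xmat Vσ (symp N) * (Vζ - Vσ)⁻¹ * Xmat Vσ (symp N) := by
  obtain ⟨hXT, hXu, hX⟩ := Xmat_facts hVσpd (symp_mul_symp N) (symp_transpose N) hVσpdC
  generalize Xmat Vσ (symp N) = X at *
  obtain ⟨D, hD⟩ : ∃ D, D = Vσ - Vζ := ⟨_, rfl⟩
  rw [← hD] at hdiff
  have hDu : IsUnit D.det := (isUnit_iff_isUnit_det _).1 hdiff.isUnit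
  have hDT : Dᵀ = D := by
    rw [← conjTranspose_eq_transpose_of_trivial]; exact hdiff.isHermitian
  have hneg : (Vζ - Vσ)⁻¹ = -D⁻¹ := by
    apply inv_eq_right_inv
    rw [show Vζ - Vσ = -D by rw [hD]; abel, neg_mul_neg, mul_nonsing_inv _ hDu]
  have hW : -Vσ - X * (Vζ - Vσ)⁻¹ * X = X * D⁻¹ * X - Vσ := by
    rw [hneg]; noncomm_ring
  refine ⟨_, ?_, ?_, ?_, rfl⟩
  · rw [hW, IsSymm, transpose_sub, transpose_mul, transpose_mul, hXT, transpose_nonsing_inv, hDT,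
      hVσsymm.eq, mul_assoc]
  · rw [hW]
    unfold BonaFide at hVζbf ⊢
    have hDC : cplx D * cplx D⁻¹ = 1 := by rw [← cplx_mul, mul_nonsing_inv _ hDu, cplx_one]
    have hDi : (cplx D)⁻¹ = cplx D⁻¹ := inv_eq_right_inv hDC
    have hDCu : IsUnit (cplx D).det := by
      rw [cplx_det]
      exact hDu.map Complex.ofRealHom
    have hQD : (cplx Vσ + Complex.I • cplx (symp N) - cplx D).PosSemidef := by
      have e : cplx Vσ + Complex.I • cplx (symp N) - cplx D
          = cplx Vζ + Complex.I • cplx (symp N) := by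
        rw [hD, cplx_sub]; abel
      rwa [e]
    have h1 := inv_sub_inv_psd (cplx_posSemidef hdiff.posSemidef) hDCu hVσpdC.posSemidef
      ((isUnit_iff_isUnit_det _).1 hVσpdC.isUnit) hQD
    have h2 := h1.mul_mul_conjTranspose_same (cplx X)
    rw [cplx_conjTranspose, hXT, mul_sub, sub_mul, hX, hDi] at h2
    have e : cplx (X * D⁻¹ * X - Vσ) + Complex.I • cplx (symp N)
        = cplx X * cplx D⁻¹ * cplx X - (cplx Vσ - Complex.I • cplx (symp N)) := by
      rw [cplx_sub, cplx_mul, cplx_mul]; abel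
    rwa [e]
  · rw [hW]
    have e : Vσ + (X * D⁻¹ * X - Vσ) = X * D⁻¹ * X := by abel
    have hX1 : X * X⁻¹ = 1 := mul_nonsing_inv _ hXu
    have hX2 : X⁻¹ * X = 1 := nonsing_inv_mul _ hXu
    rw [e, Matrix.mul_inv_rev, Matrix.mul_inv_rev, nonsing_inv_nonsing_inv _ hDu]
    calc _ = Vσ - (X * X⁻¹) * D * (X⁻¹ * X) := by noncomm_ring
      _ = Vζ := by rw [hX1, hX2, one_mul, mul_one, hD]; abel
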